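/- For any two complex n×n matrices X and Y, the squared Frobenius norm of the commutator satisfies ‖[X,Y]‖² ≤ 2‖X‖²‖Y‖². -/

import Mathlib

open Matrix
open scoped ComplexOrder

lemma bw_scalar {n : ℕ} (l : Fin n → ℝ) :
    ∃ a : ℝ, ∀ i, (l i - a) ^ 2 ≤ (∑ j, l j ^ 2) / 2 := by
  rcases isEmpty_or_nonempty (Fin n) with h | h
  · exact ⟨0, fun i => (h.false i).elim⟩
  obtain ⟨p, hp⟩ := Finite.exists_max l
  obtain ⟨q, hq⟩ := Finite.exists_min l
  refine ⟨(l p + l q) / 2, fun i => ?_⟩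
  by_cases hpq : p = q
  · subst hpq
    have h1 : l i = l p := le_antisymm (hp i) (hq i)
    have : 0 ≤ ∑ j, l j ^ 2 := Finset.sum_nonneg fun _ _ => sq_nonneg _
    rw [h1]; ring_nf; linarith
  · have h2 : l p ^ 2 + l q ^ 2 ≤ ∑ j, l j ^ 2 := by
      rw [← Finset.sum_pair (f := fun j => l j ^ 2) hpq]
      exact Finset.sum_le_sum_of_subset_of_nonneg (Finset.subset_univ _)
        fun _ _ _ => sq_nonneg _
    nlinarith [hp i, hq i, mul_nonneg (sub_nonneg.2 (hp i)) (sub_nonneg.2 (hq i)),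
      sq_nonneg (l p + l q)]

lemma bw_herm {n : ℕ} {A : Matrix (Fin n) (Fin n) ℂ} (hA : A.IsHermitian) :
    ∃ a : ℝ, ∀ P : Matrix (Fin n) (Fin n) ℂ, P.PosSemidef →
      (trace (P * ((A - (a : ℂ) • 1) * (A - (a : ℂ) • 1)))).re ≤
        (trace P).re * ((trace (A * A)).re / 2) := by
  obtain ⟨a, ha⟩ := bw_scalar hA.eigenvalues
  refine ⟨a, fun P hP => ?_⟩
  obtain ⟨U, hU, hU', hs⟩ : ∃ U : Matrix (Fin n) (Fin n) ℂ, Uᴴ * U = 1 ∧ U * Uᴴ = 1 ∧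
      A = U * diagonal (fun i => (hA.eigenvalues i : ℂ)) * Uᴴ := by
    refine ⟨hA.eigenvectorUnitary, ?_, ?_, ?_⟩
    · exact Unitary.coe_star_mul_self hA.eigenvectorUnitary
    · exact Unitary.coe_mul_star_self hA.eigenvectorUnitary
    · conv_lhs => rw [hA.spectral_theorem]
      rfl
  generalize hA.eigenvalues = l at *
  have key : ∀ d e : Fin n → ℂ, (U * diagonal d * Uᴴ) * (U * diagonal e * Uᴴ) =
      U * diagonal (fun i => d i * e i) * Uᴴ := by
    intro d e
    calc _ = U * diagonal d * (Uᴴ * U) * diagonal e * Uᴴ := by simp only [Matrix.mul_assoc]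
      _ = _ := by rw [hU, Matrix.mul_one, Matrix.mul_assoc U, diagonal_mul_diagonal]
  have hsub : A - (a : ℂ) • 1 = U * diagonal (fun i => ((l i : ℂ) - a)) * Uᴴ := by
    have : diagonal (fun i => ((l i : ℂ) - a)) = diagonal (fun i => (l i : ℂ)) - (a : ℂ) • 1 := by
      rw [smul_one_eq_diagonal, diagonal_sub]
    rw [this, Matrix.mul_sub, Matrix.sub_mul, ← hs]
    simp [hU']
  have hAA : (trace (A * A)).re = ∑ i, l i ^ 2 := by
    rw [hs, key, trace_mul_comm, ← Matrix.mul_assoc, hU, Matrix.one_mul, trace_diagonal]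
    simp [Complex.re_sum, sq]
  have hQ : (Uᴴ * P * U).PosSemidef := hP.conjTranspose_mul_mul_same U
  have htr : trace P = trace (Uᴴ * P * U) := by
    rw [trace_mul_comm, ← Matrix.mul_assoc, hU', Matrix.one_mul]
  have hPA : trace (P * (U * diagonal (fun i => ((l i : ℂ) - a) * ((l i : ℂ) - a)) * Uᴴ)) =
      trace ((Uᴴ * P * U) * diagonal (fun i => ((l i : ℂ) - a) * ((l i : ℂ) - a))) := by
    rw [← Matrix.mul_assoc, trace_mul_comm]
    simp only [Matrix.mul_assoc]
  rw [hsub, key, hPA, hAA, htr]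
  generalize Uᴴ * P * U = Q at *
  simp only [trace, diag_apply, mul_diagonal, Complex.re_sum, Finset.sum_mul]
  refine Finset.sum_le_sum fun i _ => ?_
  have h0 : 0 ≤ (Q i i).re := (Complex.le_def.1 (hQ.diag_nonneg (i := i))).1
  have : (Q i i * (((l i : ℂ) - a) * ((l i : ℂ) - a))).re = (Q i i).re * (l i - a) ^ 2 := by
    simp [Complex.mul_re, Complex.mul_im, sq]
  rw [this]
  exact mul_le_mul_of_nonneg_left (ha i) h0

lemma bw_id {n : ℕ} (X Y : Matrix (Fin n) (Fin n) ℂ) :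
    (trace ((X * Y - Y * X) * (X * Y - Y * X)ᴴ)).re ≤
      (trace ((Y * Yᴴ + Yᴴ * Y) * (Xᴴ * X + X * Xᴴ))).re := by
  have hN : 0 ≤ (trace ((Xᴴ * Y + Y * Xᴴ) * (Xᴴ * Y + Y * Xᴴ)ᴴ)).re :=
    (Complex.le_def.1 (posSemidef_self_mul_conjTranspose (Xᴴ * Y + Y * Xᴴ)).trace_nonneg).1
  have c1 : (trace (X * Y * (Xᴴ * Yᴴ))).re = (trace (Y * Xᴴ * (Yᴴ * X))).re := by
    rw [trace_mul_comm (Y * Xᴴ), Matrix.mul_assoc Yᴴ, trace_mul_comm Yᴴ]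
    simp only [Matrix.mul_assoc]
  have c2 : (trace (Y * X * (Yᴴ * Xᴴ))).re = (trace (Xᴴ * Y * (X * Yᴴ))).re := by
    rw [← Matrix.mul_assoc, trace_mul_comm]
    simp only [Matrix.mul_assoc]
  have e1 : trace (X * Y * (Yᴴ * Xᴴ)) = trace (Y * Yᴴ * (Xᴴ * X)) := by
    rw [Matrix.mul_assoc, trace_mul_comm]; simp only [Matrix.mul_assoc]
  have e2 : trace (Y * X * (Xᴴ * Yᴴ)) = trace (Yᴴ * Y * (X * Xᴴ)) := by
    rw [← Matrix.mul_assoc, trace_mul_comm]; simp only [Matrix.mul_assoc]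
  have e3 : trace (Xᴴ * Y * (Yᴴ * X)) = trace (Y * Yᴴ * (X * Xᴴ)) := by
    rw [Matrix.mul_assoc, trace_mul_comm]; simp only [Matrix.mul_assoc]
  have e4 : trace (Y * Xᴴ * (X * Yᴴ)) = trace (Yᴴ * Y * (Xᴴ * X)) := by
    rw [← Matrix.mul_assoc, trace_mul_comm]; simp only [Matrix.mul_assoc]
  simp only [conjTranspose_add, conjTranspose_sub, conjTranspose_mul, conjTranspose_conjTranspose,
    Matrix.mul_add, Matrix.add_mul, Matrix.mul_sub, Matrix.sub_mul, trace_add, trace_sub,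
    Complex.add_re, Complex.sub_re, e1, e2, e3, e4, c1, c2] at hN ⊢
  linarith

/-- Böttcher–Wenzel inequality for complex matrices. -/
theorem bw_complex (n : ℕ) (X Y : Matrix (Fin n) (Fin n) ℂ) :
    (trace ((X * Y - Y * X) * (X * Y - Y * X)ᴴ)).re ≤
      2 * (trace (X * Xᴴ)).re * (trace (Y * Yᴴ)).re := by
  obtain ⟨A, B, hA, hB, rfl⟩ : ∃ A B : Matrix (Fin n) (Fin n) ℂ,
      A.IsHermitian ∧ B.IsHermitian ∧ X = A + Complex.I • B := by
    refine ⟨(1 / 2 : ℂ) • (X + Xᴴ), (-Complex.I / 2) • (X - Xᴴ), ?_, ?_, ?_⟩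
    · ext i j; simp; ring
    · ext i j; simp; ring
    · ext i j; simp; ring_nf; simp; ring
  obtain ⟨a, ha⟩ := bw_herm hA
  obtain ⟨b, hb⟩ := bw_herm hB
  have hP : (Y * Yᴴ + Yᴴ * Y).PosSemidef :=
    (posSemidef_self_mul_conjTranspose Y).add (posSemidef_conjTranspose_mul_self Y)
  have ha := ha _ hP
  have hb := hb _ hP
  have h := bw_id ((A - (a : ℂ) • 1) + Complex.I • (B - (b : ℂ) • 1)) Y
  have sq2 : ∀ {C D : Matrix (Fin n) (Fin n) ℂ}, C.IsHermitian → D.IsHermitian →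
      (C + Complex.I • D)ᴴ * (C + Complex.I • D) + (C + Complex.I • D) * (C + Complex.I • D)ᴴ
        = (2 : ℂ) • (C * C + D * D) := by
    intro C D hC hD
    simp only [conjTranspose_add, conjTranspose_smul, hC.eq, hD.eq, Matrix.mul_add, Matrix.add_mul,
      Matrix.smul_mul, Matrix.mul_smul, smul_smul, smul_add, Complex.star_def, Complex.conj_I,
      neg_smul, smul_neg, neg_mul, mul_neg, Complex.I_mul_I, two_smul, one_smul, neg_neg]
    abel
  have hsh : ∀ {C : Matrix (Fin n) (Fin n) ℂ} (c : ℝ), C.IsHermitian →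
      (C - (c : ℂ) • 1).IsHermitian := by
    intro C c hC
    simp [IsHermitian, conjTranspose_sub, conjTranspose_smul, hC.eq]
  have hcomm : ((A - (a : ℂ) • 1) + Complex.I • (B - (b : ℂ) • 1)) * Y -
      Y * ((A - (a : ℂ) • 1) + Complex.I • (B - (b : ℂ) • 1)) =
      (A + Complex.I • B) * Y - Y * (A + Complex.I • B) := by
    simp only [Matrix.mul_add, Matrix.add_mul, Matrix.mul_sub, Matrix.sub_mul, Matrix.smul_mul,
      Matrix.mul_smul, smul_sub, Matrix.one_mul, Matrix.mul_one]
    abel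
  rw [hcomm, sq2 (hsh a hA) (hsh b hB)] at h
  have hX : (trace ((A + Complex.I • B) * (A + Complex.I • B)ᴴ)).re =
      (trace (A * A)).re + (trace (B * B)).re := by
    have h1 := congrArg (fun M => (trace M).re) (sq2 hA hB)
    simp only [trace_add, trace_smul, trace_mul_comm (A + Complex.I • B)ᴴ] at h1
    simp at h1 ⊢
    linarith
  have hY : (trace (Y * Yᴴ + Yᴴ * Y)).re = 2 * (trace (Y * Yᴴ)).re := by
    rw [trace_add, trace_mul_comm Yᴴ, Complex.add_re]; ring
  rw [hY] at ha hb
  rw [hX]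
  generalize Y * Yᴴ + Yᴴ * Y = P at *
  rw [Matrix.mul_smul, trace_smul, Matrix.mul_add P, trace_add] at h
  have h2 : ∀ z : ℂ, ((2 : ℂ) • z).re = 2 * z.re := by intro z; simp
  rw [h2, Complex.add_re] at h
  linarith
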